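/- Let n ≥ 4 and let i ∈ ZMod n be a vertex of a convex n-gon. The 'sun' at i, namely the set consisting of all diagonals having i as an endpoint together with the ear-cover {i−1, i+1}, is a blocking set, and it has exactly n−2 elements. -/

import Mathlib

namespace ConvexBlockers

/-- Cyclic distance between two vertices of the convex `n`-gon (vertices = `ZMod n`). -/
def cyclicDist {n : ℕ} (i j : ZMod n) : ℕ := min (i - j).val (j - i).val

/-- A diagonal: an unordered pair of vertices at cyclic distance at least 2. -/
def IsDiagonal {n : ℕ} (e : Sym2 (ZMod n)) : Prop :=
  ∃ i j : ZMod n, e = s(i, j) ∧ 2 ≤ cyclicDist i j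

/-- An ear-cover: a diagonal of cyclic distance exactly 2. -/
def IsEarCover {n : ℕ} (e : Sym2 (ZMod n)) : Prop :=
  ∃ i j : ZMod n, e = s(i, j) ∧ cyclicDist i j = 2

/-- `Btw a x b` : `x` lies strictly inside the clockwise arc from `a` to `b`. -/
def Btw {n : ℕ} (a x b : ZMod n) : Prop :=
  0 < (x - a).val ∧ (x - a).val < (b - a).val

/-- Two diagonals cross iff their endpoint pairs strictly interleave in the cyclic order. -/
def Crosses {n : ℕ} (e f : Sym2 (ZMod n)) : Prop :=
  ∃ a b c d : ZMod n, e = s(a, b) ∧ f = s(c, d) ∧ Btw a c b ∧ Btw b d a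

/-- A triangulation: a maximal (w.r.t. inclusion) set of pairwise non-crossing diagonals. -/
def IsTriangulation {n : ℕ} (T : Set (Sym2 (ZMod n))) : Prop :=
  (∀ e ∈ T, IsDiagonal e) ∧
  (∀ e ∈ T, ∀ f ∈ T, ¬ Crosses e f) ∧
  (∀ T' : Set (Sym2 (ZMod n)), (∀ e ∈ T', IsDiagonal e) →
    (∀ e ∈ T', ∀ f ∈ T', ¬ Crosses e f) → T ⊆ T' → T' = T)

/-- A blocking set: a set of diagonals meeting every triangulation. -/
def IsBlockingSet {n : ℕ} (B : Set (Sym2 (ZMod n))) : Prop :=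
  (∀ e ∈ B, IsDiagonal e) ∧
  ∀ T : Set (Sym2 (ZMod n)), IsTriangulation T → (B ∩ T).Nonempty

/-- A blocker: a blocking set of minimum possible cardinality. -/
def IsBlocker {n : ℕ} (B : Set (Sym2 (ZMod n))) : Prop :=
  IsBlockingSet B ∧
  ∀ B' : Set (Sym2 (ZMod n)), IsBlockingSet B' → B.ncard ≤ B'.ncard

lemma two_le_val_iff {n : ℕ} (hn : 2 ≤ n) (x : ZMod n) : 2 ≤ x.val ↔ x ≠ 0 ∧ x ≠ 1 := by
  have : NeZero n := ⟨by omega⟩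
  have : Fact (1 < n) := ⟨hn⟩
  have h0 : x.val = 0 ↔ x = 0 := ZMod.val_eq_zero x
  have h1 : x.val = 1 ↔ x = 1 := by
    rw [← ZMod.val_one n, (ZMod.val_injective n).eq_iff]
  rw [Ne, Ne, ← h0, ← h1]
  omega

lemma two_le_cyclicDist_iff {n : ℕ} (hn : 2 ≤ n) (i j : ZMod n) :
    2 ≤ cyclicDist i j ↔ j ≠ i ∧ j ≠ i - 1 ∧ j ≠ i + 1 := by
  rw [cyclicDist, le_min_iff, two_le_val_iff hn, two_le_val_iff hn]
  grind

lemma cyclicDist_comm {n : ℕ} (i j : ZMod n) : cyclicDist i j = cyclicDist j i :=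
  min_comm _ _

lemma isDiagonal_mk_iff {n : ℕ} (i j : ZMod n) : IsDiagonal s(i, j) ↔ 2 ≤ cyclicDist i j := by
  refine ⟨?_, fun h => ⟨i, j, rfl, h⟩⟩
  rintro ⟨a, b, hab, h⟩
  rcases Sym2.eq_iff.1 hab with ⟨rfl, rfl⟩ | ⟨rfl, rfl⟩
  · exact h
  · rwa [cyclicDist_comm]

lemma natCast_ne_zero {n k : ℕ} (hk : 0 < k) (hkn : k < n) : (k : ZMod n) ≠ 0 := by
  rw [Ne, ZMod.natCast_eq_zero_iff]
  exact Nat.not_dvd_of_pos_of_lt hk hkn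

lemma val_sub_eq_ite {n : ℕ} [NeZero n] (x y : ZMod n) :
    (x - y).val = if y.val ≤ x.val then x.val - y.val else n + x.val - y.val := by
  split_ifs with h
  · exact ZMod.val_sub h
  · have hne : y - x ≠ 0 := by
      intro h'
      rw [sub_eq_zero.1 h'] at h
      exact h le_rfl
    have : NeZero (y - x) := ⟨hne⟩
    rw [← neg_sub, ZMod.val_neg_of_ne_zero, ZMod.val_sub (by omega)]
    omega

lemma Crosses.symm {n : ℕ} [NeZero n] {e f : Sym2 (ZMod n)} (h : Crosses e f) : Crosses f e := by
  obtain ⟨a, b, c, d, rfl, rfl, h₁, h₂⟩ := h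
  refine ⟨c, d, b, a, rfl, Sym2.eq_swap, ?_⟩
  have ha := a.val_lt
  have hb := b.val_lt
  have hc := c.val_lt
  have hd := d.val_lt
  simp only [Btw, val_sub_eq_ite] at *
  split_ifs at * <;> omega

lemma not_crosses_self {n : ℕ} (e : Sym2 (ZMod n)) : ¬ Crosses e e := by
  rintro ⟨a, b, c, d, rfl, h, ⟨h₁, h₂⟩, ⟨h₃, h₄⟩⟩
  rcases Sym2.eq_iff.1 h with ⟨rfl, rfl⟩ | ⟨rfl, rfl⟩
  · simp at h₁
  · exact lt_irrefl _ h₂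

lemma Btw.eq_of_pred_succ {n : ℕ} (hn : 3 ≤ n) {i c : ZMod n} (h : Btw (i - 1) c (i + 1)) :
    c = i := by
  obtain ⟨h₁, h₂⟩ := h
  have hv : (i + 1 - (i - 1)).val = 2 := by
    rw [show i + 1 - (i - 1) = ((2 : ℕ) : ZMod n) by push_cast; ring]
    exact ZMod.val_cast_of_lt hn
  have h3 := two_le_val_iff (by omega) (c - (i - 1))
  have h0 : c - (i - 1) ≠ 0 := by
    intro h
    simp [h] at h₁
  have : c - (i - 1) = 1 := by
    by_contra h
    have := h3.2 ⟨h0, h⟩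
    omega
  grind

/-- A diagonal crossing the ear-cover of `i` has `i` as an endpoint. -/
lemma Crosses.mem_of_earCover {n : ℕ} (hn : 3 ≤ n) {i : ZMod n} {f : Sym2 (ZMod n)}
    (h : Crosses s(i - 1, i + 1) f) : i ∈ f := by
  obtain ⟨a, b, c, d, he, rfl, h₁, h₂⟩ := h
  rcases Sym2.eq_iff.1 he with ⟨rfl, rfl⟩ | ⟨rfl, rfl⟩
  · rw [h₁.eq_of_pred_succ hn]
    exact Sym2.mem_mk_left _ _
  · rw [h₂.eq_of_pred_succ hn]
    exact Sym2.mem_mk_right _ _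

lemma isDiagonal_earCover {n : ℕ} (hn : 4 ≤ n) (i : ZMod n) :
    IsDiagonal s(i - 1, i + 1) := by
  rw [isDiagonal_mk_iff, two_le_cyclicDist_iff (by omega)]
  have h1 := natCast_ne_zero (n := n) (k := 1) (by omega) (by omega)
  have h2 := natCast_ne_zero (n := n) (k := 2) (by omega) (by omega)
  have h3 := natCast_ne_zero (n := n) (k := 3) (by omega) (by omega)
  push_cast at h1 h2 h3
  refine ⟨fun h => h2 ?_, fun h => h3 ?_, fun h => h1 ?_⟩ <;> linear_combination h

/-- A diagonal that crosses no member of a triangulation belongs to it. -/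
lemma IsTriangulation.mem_of_forall_not_crosses {n : ℕ} [NeZero n] {T : Set (Sym2 (ZMod n))}
    (hT : IsTriangulation T) {e : Sym2 (ZMod n)} (he : IsDiagonal e)
    (h : ∀ f ∈ T, ¬ Crosses e f) : e ∈ T := by
  obtain ⟨hd, hc, hmax⟩ := hT
  rw [← hmax (insert e T) ?_ ?_ (Set.subset_insert e T)]
  · exact Set.mem_insert e T
  · rintro f (rfl | hf)
    exacts [he, hd f hf]
  · rintro f (rfl | hf) g (rfl | hg)
    · exact not_crosses_self _
    · exact h g hg
    · exact fun hfg => h f hf hfg.symm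
    · exact hc f hf g hg

lemma setOf_isDiagonal_mem_eq_image {n : ℕ} (hn : 2 ≤ n) (i : ZMod n) :
    {e : Sym2 (ZMod n) | IsDiagonal e ∧ i ∈ e} =
      (fun j => s(i, j)) '' ({i, i - 1, i + 1} : Set (ZMod n))ᶜ := by
  ext e
  constructor
  · rintro ⟨hd, j, rfl⟩
    rw [isDiagonal_mk_iff, two_le_cyclicDist_iff hn] at hd
    exact ⟨j, by simpa using hd, rfl⟩
  · rintro ⟨j, hj, rfl⟩
    refine ⟨?_, Sym2.mem_mk_left _ _⟩
    rw [isDiagonal_mk_iff, two_le_cyclicDist_iff hn]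
    simpa using hj

lemma ncard_setOf_isDiagonal_mem {n : ℕ} (hn : 3 ≤ n) (i : ZMod n) :
    {e : Sym2 (ZMod n) | IsDiagonal e ∧ i ∈ e}.ncard = n - 3 := by
  have : NeZero n := ⟨by omega⟩
  have h1 := natCast_ne_zero (n := n) (k := 1) (by omega) (by omega)
  have h2 := natCast_ne_zero (n := n) (k := 2) (by omega) (by omega)
  push_cast at h1 h2
  rw [setOf_isDiagonal_mem_eq_image (by omega),
    Set.ncard_image_of_injective _ fun _ _ h => Sym2.congr_right.1 h, Set.ncard_compl,
    Nat.card_zmod, Set.ncard_eq_three.2]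
  refine ⟨i, i - 1, i + 1, fun h => h1 ?_, fun h => h1 ?_, fun h => h2 ?_, rfl⟩
  · linear_combination h
  · linear_combination -h
  · linear_combination -h

/-- The 'sun' at a vertex i (all diagonals through i together with the
ear-cover {i-1, i+1}) is a blocking set of size exactly n-2. -/
theorem sun_is_blocking {n : ℕ} (hn : 4 ≤ n) (i : ZMod n) :
    IsBlockingSet ({e : Sym2 (ZMod n) | IsDiagonal e ∧ i ∈ e} ∪ {s(i - 1, i + 1)}) ∧
    ({e : Sym2 (ZMod n) | IsDiagonal e ∧ i ∈ e} ∪ {s(i - 1, i + 1)}).ncard = n - 2 := by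
  have : NeZero n := ⟨by omega⟩
  refine ⟨⟨?_, fun T hT => ?_⟩, ?_⟩
  · rintro e (⟨he, -⟩ | rfl)
    exacts [he, isDiagonal_earCover hn i]
  · by_cases h : ∃ f ∈ T, i ∈ f
    · obtain ⟨f, hf, hi⟩ := h
      exact ⟨f, Or.inl ⟨hT.1 f hf, hi⟩, hf⟩
    · exact ⟨_, Or.inr rfl, hT.mem_of_forall_not_crosses (isDiagonal_earCover hn i)
        fun f hf hc => h ⟨f, hf, hc.mem_of_earCover (by omega)⟩⟩
  · have : Fact (1 < n) := ⟨by omega⟩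
    have hi : s(i - 1, i + 1) ∉ {e : Sym2 (ZMod n) | IsDiagonal e ∧ i ∈ e} := by
      simp [Sym2.mem_iff, eq_sub_iff_add_eq]
    rw [Set.union_singleton, Set.ncard_insert_of_notMem hi (Set.toFinite _),
      ncard_setOf_isDiagonal_mem (by omega)]
    omega

end ConvexBlockers
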